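/- arXiv:1605.01207 — 2 statements merged into one kernel-verified Lean document; each statement's English description precedes it below -/
import Mathlib

section
/- Let T be a tree and D a connected subset of its vertices with m vertices and at most one boundary vertex. Then there exists a vertex v of D whose removal splits D into connected subtrees each of size at most m/2 + 1 and each having at most 2 boundary vertices. -/
/-- Reachability inside a set `D` of vertices of a graph `G`. -/
def ReachIn {V : Type*} (G : SimpleGraph V) (D : Set V) (x y : V) : Prop :=
  Relation.ReflTransGen (fun a b => a ∈ D ∧ b ∈ D ∧ G.Adj a b) x y

/-- A set `D` of vertices is connected (a subtree) in `G`. -/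
def ConnIn {V : Type*} (G : SimpleGraph V) (D : Set V) : Prop :=
  ∀ x ∈ D, ∀ y ∈ D, ReachIn G D x y

/-- The boundary vertices of `D`: vertices of `D` adjacent in `G` to a vertex outside `D`. -/
def bdry {V : Type*} (G : SimpleGraph V) (D : Set V) : Set V :=
  {v | v ∈ D ∧ ∃ u, u ∉ D ∧ G.Adj v u}

/-- The connected component of `x` in `D \ {v}`; together with `v` it forms one of the
subtrees split off by the removal of `v` from `D`. -/
def piece {V : Type*} (G : SimpleGraph V) (D : Set V) (v x : V) : Set V :=
  {y | y ∈ D \ {v} ∧ ReachIn G (D \ {v}) x y}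

theorem ReachIn.reverse_reach {V : Type*} {G : SimpleGraph V} {D : Set V} {x y : V}
    (h : ReachIn G D x y) : ReachIn G D y x := by
  induction h with
  | refl => exact Relation.ReflTransGen.refl
  | tail _ h ih => exact Relation.ReflTransGen.head ⟨h.2.1, h.1, h.2.2.symm⟩ ih

theorem ReachIn.exists_adj {V : Type*} {G : SimpleGraph V} {D : Set V} {x v : V}
    (h : ReachIn G D x v) (hx : x ≠ v) :
    ∃ w ∈ piece G D v x, G.Adj w v := by
  induction h using Relation.ReflTransGen.head_induction_on with
  | refl => exact absurd rfl hx
  | @head a b hab _ ih =>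
    by_cases hb : b = v
    · subst hb
      exact ⟨a, ⟨⟨hab.1, hx⟩, Relation.ReflTransGen.refl⟩, hab.2.2⟩
    · obtain ⟨w, hw, hwv⟩ := ih hb
      exact ⟨w, ⟨hw.1, Relation.ReflTransGen.head ⟨⟨hab.1, hx⟩, ⟨hab.2.1, hb⟩, hab.2.2⟩ hw.2⟩, hwv⟩

theorem ReachIn.reachable_del {V : Type*} {G : SimpleGraph V} {D : Set V} {x y a b : V}
    (h : ReachIn G D x y) (hab : a ∉ D ∨ b ∉ D) :
    (G.deleteEdges {s(a, b)}).Reachable x y := by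
  induction h with
  | refl => exact SimpleGraph.Reachable.refl _
  | @tail c d _ h ih =>
    refine ih.trans (SimpleGraph.Adj.reachable ?_)
    rw [SimpleGraph.deleteEdges_adj]
    refine ⟨h.2.2, ?_⟩
    have h1 := h.1
    have h2 := h.2.1
    intro he
    rw [Set.mem_singleton_iff, Sym2.eq_iff] at he
    rcases he with ⟨rfl, rfl⟩ | ⟨rfl, rfl⟩ <;> tauto

theorem bdry_piece {V : Type*} (T : SimpleGraph V) (D : Set V) (hfin : D.Finite)
    (hbd : (bdry T D).ncard ≤ 1) (v x : V) :
    (bdry T (insert v (piece T D v x))).ncard ≤ 2 := by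
  have hsub : bdry T (insert v (piece T D v x)) ⊆ insert v (bdry T D) := by
    rintro y ⟨hy, u, hu, hadj⟩
    rcases hy with rfl | hy
    · exact Or.inl rfl
    · right
      refine ⟨hy.1.1, u, fun huD => hu ?_, hadj⟩
      by_cases huv : u = v
      · exact Or.inl huv
      · exact Or.inr ⟨⟨huD, huv⟩, hy.2.tail ⟨hy.1, ⟨huD, huv⟩, hadj⟩⟩
  have hf : (bdry T D).Finite := hfin.subset fun y hy => hy.1
  have h1 := Set.ncard_le_ncard hsub (hf.insert v)
  have h2 := Set.ncard_insert_le v (bdry T D)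
  omega

theorem centroid {V : Type*} (T : SimpleGraph V) (hT : T.IsTree)
    (D : Set V) (hfin : D.Finite) (hne : D.Nonempty) (hconn : ConnIn T D) :
    ∃ v ∈ D, ∀ x ∈ D \ {v}, 2 * (piece T D v x).ncard ≤ D.ncard := by
  by_contra! hcon
  have key : ∀ n : ℕ, ∀ v ∈ D, ∀ x ∈ D \ {v}, D.ncard < 2 * (piece T D v x).ncard →
      (piece T D v x).ncard = n → False := by
    intro n
    induction n using Nat.strong_induction_on with
    | _ n ih =>
      intro v hv x hx hbig hn
      have hPsub : piece T D v x ⊆ D := fun y hy => hy.1.1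
      have hPfin := hfin.subset hPsub
      obtain ⟨w, hw, hwv⟩ := (hconn x hx.1 v hv).exists_adj hx.2
      obtain ⟨z, hz, hzbig⟩ := hcon w hw.1.1
      have hQsub : piece T D w z ⊆ D := fun y hy => hy.1.1
      have hQfin := hfin.subset hQsub
      obtain ⟨y, hyP, hyQ⟩ : (piece T D v x ∩ piece T D w z).Nonempty := by
        rw [Set.nonempty_iff_ne_empty]
        intro he
        have h1 := Set.ncard_union_eq (Set.disjoint_iff_inter_eq_empty.2 he) hPfin hQfin
        have h2 := Set.ncard_le_ncard (Set.union_subset hPsub hQsub) hfin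
        omega
      have hvQ : v ∉ piece T D w z := by
        intro hvQ
        have r1 : (T.deleteEdges {s(w, v)}).Reachable w y :=
          (hw.2.reverse_reach.reachable_del (Or.inr (by simp))).trans
            (hyP.2.reachable_del (Or.inr (by simp)))
        have r2 : (T.deleteEdges {s(w, v)}).Reachable y v :=
          (hyQ.2.reverse_reach.reachable_del (Or.inl (by simp))).trans
            (hvQ.2.reachable_del (Or.inl (by simp)))
        have hb := SimpleGraph.isAcyclic_iff_forall_adj_isBridge.1 hT.isAcyclic hwv
        rw [SimpleGraph.isBridge_iff] at hb
        exact hb (r1.trans r2)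
      have hreach : ∀ u, ReachIn T (D \ {w}) z u → ReachIn T (D \ {v}) z u := by
        intro u hu
        induction hu with
        | refl => exact Relation.ReflTransGen.refl
        | @tail c d hc hcd ihc =>
          refine ihc.tail ⟨⟨hcd.1.1, ?_⟩, ⟨hcd.2.1.1, ?_⟩, hcd.2.2⟩
          · rintro rfl
            exact hvQ ⟨hcd.1, hc⟩
          · rintro rfl
            exact hvQ ⟨hcd.2.1, hc.tail hcd⟩
      have hQP : piece T D w z ⊆ piece T D v x := by
        intro u hu
        refine ⟨⟨hu.1.1, ?_⟩, ?_⟩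
        · rintro rfl
          exact hvQ hu
        · exact (hyP.2.trans (hreach y hyQ.2).reverse_reach).trans (hreach u hu.2)
      have hlt : (piece T D w z).ncard < (piece T D v x).ncard := by
        apply Set.ncard_lt_ncard _ hPfin
        exact ⟨hQP, fun h => (h hw).1.2 rfl⟩
      exact ih _ (hn ▸ hlt) w hw.1.1 z hz hzbig rfl
  obtain ⟨v, hv⟩ := hne
  obtain ⟨x, hx, hb⟩ := hcon v hv
  exact key _ v hv x hx hb rfl

/-- Let `T` be a tree and `D` a connected subset of its vertices with `m`
vertices and at most one boundary vertex.  Then there exists a vertex `v` of `D` whose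
removal splits `D` into connected subtrees each of size at most `m/2 + 1` and each having
at most 2 boundary vertices. -/
theorem stmt_5 {V : Type*} (T : SimpleGraph V) (hT : T.IsTree)
    (D : Set V) (hfin : D.Finite) (hne : D.Nonempty) (hconn : ConnIn T D)
    (hbd : (bdry T D).ncard ≤ 1) :
    ∃ v ∈ D, ∀ x ∈ D \ {v},
      2 * (insert v (piece T D v x)).ncard ≤ D.ncard + 2 ∧
      (bdry T (insert v (piece T D v x))).ncard ≤ 2 := by
  obtain ⟨v, hv, h⟩ := centroid T hT D hfin hne hconn
  refine ⟨v, hv, fun x hx => ⟨?_, bdry_piece T D hfin hbd v x⟩⟩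
  have h1 := h x hx
  have h2 := Set.ncard_insert_le v (piece T D v x)
  omega
end

section
/- Let H = (V, E) be a tree hypergraph whose underlying tree has at most ℓ leaves, for a fixed ℓ ≥ 2. Then the hypergraph function f_H can be computed by a nondeterministic branching program of size polynomial in |H|. -/
/-- A nonempty set `S` of edges of the graph `T` induces a convex subtree: the edges of `S`
are connected to each other (consecutive edges share a vertex), and every non-leaf vertex
of the subtree (a vertex incident to at least two edges of `S`) retains all its `T`-edges. -/
def ConvexSub {VT : Type*} (T : SimpleGraph VT) (S : Finset (Sym2 VT)) : Prop :=
  S.Nonempty ∧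
  (∀ a ∈ S, ∀ b ∈ S,
    Relation.ReflTransGen (fun x y => x ∈ S ∧ y ∈ S ∧ ∃ v : VT, v ∈ x ∧ v ∈ y) a b) ∧
  (∀ v : VT, (∃ a ∈ S, ∃ b ∈ S, a ≠ b ∧ v ∈ a ∧ v ∈ b) →
    ∀ g ∈ T.edgeSet, v ∈ g → g ∈ S)

/-- Evaluation of an arc label: a Boolean constant, or a literal. -/
def litEval {ι : Type*} (α : ι → Bool) : Bool ⊕ (ι × Bool) → Bool
  | .inl b => b
  | .inr (i, pol) => α i == pol

/-- A nondeterministic branching program over an abstract set `ι` of variables. -/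
structure NBP (ι : Type*) where
  nv : ℕ
  arcs : Finset (Fin nv × Fin nv × (Bool ⊕ (ι × Bool)))
  src : Fin nv
  tgt : Fin nv

def NBP.size {ι : Type*} (B : NBP ι) : ℕ := B.nv + B.arcs.card

def NBP.Step {ι : Type*} (B : NBP ι) (α : ι → Bool) (u v : Fin B.nv) : Prop :=
  ∃ l, (u, v, l) ∈ B.arcs ∧ litEval α l = true

def NBP.Accepts {ι : Type*} (B : NBP ι) (α : ι → Bool) : Prop :=
  Relation.ReflTransGen (B.Step α) B.src B.tgt

/-- The hypergraph function `f_H` of the tree hypergraph `H` whose vertices are the edges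
of the tree `T` and whose hyperedges are the members of `E`, over vertex variables
(`Sum.inl`) and hyperedge variables (`Sum.inr`). -/
def fHtree {VT : Type*} [Fintype VT] [DecidableEq VT] (T : SimpleGraph VT)
    [DecidableRel T.Adj] (E : Finset (Finset (Sym2 VT)))
    (α : Sym2 VT ⊕ Finset (Sym2 VT) → Bool) : Prop :=
  ∃ S ⊆ E, ((S : Set (Finset (Sym2 VT))).Pairwise fun e f => Disjoint e f) ∧
    (∀ e ∈ S, α (Sum.inr e) = true) ∧
    (∀ ed ∈ T.edgeFinset, (∀ e ∈ S, ed ∉ e) → α (Sum.inl ed) = true)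


/-- Any finite labelled relation gives an NBP. -/
lemma nbp_of_rel {ι : Type*} {Q : Type*} [Fintype Q]
    (Ls : Finset (Bool ⊕ (ι × Bool))) (R : Q → Q → (Bool ⊕ (ι × Bool)) → Prop)
    (hR : ∀ q q' l, R q q' l → l ∈ Ls) (s t : Q) :
    ∃ B : NBP ι, B.size ≤ Fintype.card Q + Fintype.card Q * (Fintype.card Q * Ls.card) ∧
      ∀ α, B.Accepts α ↔
        Relation.ReflTransGen (fun q q' => ∃ l, R q q' l ∧ litEval α l = true) s t := by
  classical
  let ε := Fintype.equivFin Q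
  let n := Fintype.card Q
  let arcs : Finset (Fin n × Fin n × (Bool ⊕ (ι × Bool))) :=
    ((Finset.univ : Finset (Fin n)) ×ˢ ((Finset.univ : Finset (Fin n)) ×ˢ Ls)).filter
      (fun a => R (ε.symm a.1) (ε.symm a.2.1) a.2.2)
  refine ⟨⟨n, arcs, ε s, ε t⟩, ?_, ?_⟩
  · unfold NBP.size
    refine Nat.add_le_add_left ?_ _
    refine (Finset.card_filter_le _ _).trans ?_
    simp [Finset.card_product, n]
  · intro α
    have hmem : ∀ u v l, ((u, v, l) ∈ arcs ↔ R (ε.symm u) (ε.symm v) l) := by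
      intro u v l
      simp only [arcs, Finset.mem_filter, Finset.mem_product, Finset.mem_univ, true_and]
      exact ⟨fun h => h.2, fun h => ⟨hR _ _ _ h, h⟩⟩
    unfold NBP.Accepts
    constructor
    · intro h
      have key : ∀ v, Relation.ReflTransGen (NBP.Step ⟨n, arcs, ε s, ε t⟩ α) (ε s) v →
          Relation.ReflTransGen (fun q q' => ∃ l, R q q' l ∧ litEval α l = true) s (ε.symm v) := by
        intro v hv
        induction hv with
        | refl => simpa using Relation.ReflTransGen.refl
        | tail _ hstep ih =>
          obtain ⟨l, h1, h2⟩ := hstep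
          exact ih.tail ⟨l, (hmem _ _ _).1 h1, h2⟩
      simpa using key _ h
    · intro h
      have key : ∀ v, Relation.ReflTransGen
          (fun q q' => ∃ l, R q q' l ∧ litEval α l = true) s v →
          Relation.ReflTransGen (NBP.Step ⟨n, arcs, ε s, ε t⟩ α) (ε s) (ε v) := by
        intro v hv
        induction hv with
        | refl => exact Relation.ReflTransGen.refl
        | tail _ hstep ih =>
          obtain ⟨l, h1, h2⟩ := hstep
          exact ih.tail ⟨l, (hmem _ _ _).2 (by simpa using h1), h2⟩
      exact key _ h

/-- `e` meets both the edges with index `< k` and those with index `≥ k`. -/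
def ActiveAt {X : Type*} {m : ℕ} (g : Fin m → X) (k : ℕ) (e : Finset X) : Prop :=
  (∃ j : Fin m, (j : ℕ) < k ∧ g j ∈ e) ∧ (∃ j : Fin m, k ≤ (j : ℕ) ∧ g j ∈ e)

lemma card_small_subsets {Y : Type*} [DecidableEq Y] (E : Finset Y) (ℓ : ℕ) :
    (E.powerset.filter fun F => F.card ≤ ℓ).card ≤ (ℓ + 1) * (E.card + 1) ^ ℓ := by
  have hsub : (E.powerset.filter fun F => F.card ≤ ℓ) ⊆
      (Finset.range (ℓ + 1)).biUnion (fun j => E.powersetCard j) := by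
    intro F hF
    simp only [Finset.mem_filter, Finset.mem_powerset] at hF
    simp only [Finset.mem_biUnion, Finset.mem_range, Finset.mem_powersetCard]
    exact ⟨F.card, by omega, hF.1, rfl⟩
  refine (Finset.card_le_card hsub).trans (Finset.card_biUnion_le.trans ?_)
  have : ∀ j ∈ Finset.range (ℓ + 1), (E.powersetCard j).card ≤ (E.card + 1) ^ ℓ := by
    intro j hj
    rw [Finset.card_powersetCard]
    refine (Nat.choose_le_pow _ _).trans ?_
    refine (Nat.pow_le_pow_left (Nat.le_succ _) j).trans ?_
    exact Nat.pow_le_pow_right (by omega) (by simpa [Nat.lt_succ_iff] using hj)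
  refine (Finset.sum_le_card_nsmul _ _ _ this).trans ?_
  simp

/-- Sweeping construction. -/
lemma sweep {X : Type*} [DecidableEq X] {m : ℕ} (g : Fin m → X)
    (E : Finset (Finset X)) (hE : ∀ e ∈ E, ∀ x ∈ e, ∃ j, g j = x) (ℓ : ℕ)
    (hb : ∀ S ⊆ E, ((S : Set (Finset X)).Pairwise fun e f => Disjoint e f) →
      ∀ k, (∀ e ∈ S, ActiveAt g k e) → S.card ≤ ℓ) :
    ∃ B : NBP (X ⊕ Finset X),
      B.size ≤ ((ℓ + 1) + (ℓ + 1) ^ 2) * (m + E.card + 1) ^ (2 * ℓ + 3) ∧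
      ∀ α, B.Accepts α ↔ ∃ S ⊆ E, ((S : Set (Finset X)).Pairwise fun e f => Disjoint e f) ∧
        (∀ e ∈ S, α (Sum.inr e) = true) ∧
        (∀ j, (∀ e ∈ S, g j ∉ e) → α (Sum.inl (g j)) = true) := by
  classical
  let Fs := E.powerset.filter fun F => F.card ≤ ℓ
  let Q := Fin (m + 1) × Fs
  let Ls : Finset (Bool ⊕ ((X ⊕ Finset X) × Bool)) :=
    {Sum.inl true} ∪ ((Finset.univ : Finset (Fin m)).image fun j => Sum.inr (Sum.inl (g j), true))
      ∪ E.image fun e => Sum.inr (Sum.inr e, true)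
  let R : Q → Q → (Bool ⊕ ((X ⊕ Finset X) × Bool)) → Prop := fun q q' l =>
    ∃ j : Fin m, (q.1 : ℕ) = j ∧ (q'.1 : ℕ) = j + 1 ∧
      ((l = Sum.inr (Sum.inl (g j), true) ∧
          (q'.2 : Finset (Finset X)) = (q.2 : Finset (Finset X)).filter (ActiveAt g (j + 1))) ∨
       (l = Sum.inl true ∧ (∃ e ∈ (q.2 : Finset (Finset X)), g j ∈ e) ∧
          (q'.2 : Finset (Finset X)) = (q.2 : Finset (Finset X)).filter (ActiveAt g (j + 1))) ∨
       (∃ e ∈ E, l = Sum.inr (Sum.inr e, true) ∧ g j ∈ e ∧ (∀ j' : Fin m, j' < j → g j' ∉ e) ∧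
          (∀ f ∈ (q.2 : Finset (Finset X)), Disjoint e f) ∧
          (q'.2 : Finset (Finset X)) =
            (insert e (q.2 : Finset (Finset X))).filter (ActiveAt g (j + 1))))
  have hR : ∀ q q' l, R q q' l → l ∈ Ls := by
    rintro q q' l ⟨j, -, -, h⟩
    rcases h with ⟨rfl, -⟩ | ⟨rfl, -⟩ | ⟨e, he, rfl, -⟩
    · simp [Ls]
    · simp [Ls]
    · simp [Ls, he]
  have h0 : (∅ : Finset (Finset X)) ∈ Fs := by simp [Fs]
  obtain ⟨B, hB, hacc⟩ := nbp_of_rel Ls R hR (⟨0, by omega⟩, ⟨∅, h0⟩) (⟨m, by omega⟩, ⟨∅, h0⟩)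
  refine ⟨B, hB.trans ?_, fun α => (hacc α).trans ?_⟩
  · -- size
    set N := m + E.card + 1 with hN
    have hN1 : 1 ≤ N := by omega
    have hQ : Fintype.card Q ≤ (ℓ + 1) * N ^ (ℓ + 1) := by
      have h1 : Fintype.card Q = (m + 1) * Fs.card := by simp [Q]
      rw [h1]
      calc (m + 1) * Fs.card ≤ N * ((ℓ + 1) * N ^ ℓ) := by
            refine Nat.mul_le_mul (by omega) ((card_small_subsets E ℓ).trans ?_)
            exact Nat.mul_le_mul_left _ (Nat.pow_le_pow_left (by omega) _)
        _ = _ := by ring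
    have hL : Ls.card ≤ N := by
      refine (Finset.card_union_le _ _).trans ?_
      have h1 := Finset.card_union_le ({Sum.inl true} : Finset (Bool ⊕ ((X ⊕ Finset X) × Bool)))
        ((Finset.univ : Finset (Fin m)).image fun j => Sum.inr (Sum.inl (g j), true))
      have h2 := Finset.card_image_le (s := (Finset.univ : Finset (Fin m)))
        (f := fun j => (Sum.inr (Sum.inl (g j), true) : Bool ⊕ ((X ⊕ Finset X) × Bool)))
      have h3 := Finset.card_image_le (s := E)
        (f := fun e => (Sum.inr (Sum.inr e, true) : Bool ⊕ ((X ⊕ Finset X) × Bool)))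
      simp only [Finset.card_singleton, Finset.card_univ, Fintype.card_fin] at h1 h2
      omega
    calc Fintype.card Q + Fintype.card Q * (Fintype.card Q * Ls.card)
        ≤ (ℓ + 1) * N ^ (ℓ + 1) + ((ℓ + 1) * N ^ (ℓ + 1)) * (((ℓ + 1) * N ^ (ℓ + 1)) * N) := by
          gcongr
      _ = (ℓ + 1) * N ^ (ℓ + 1) + (ℓ + 1) ^ 2 * N ^ (2 * ℓ + 3) := by ring
      _ ≤ (ℓ + 1) * N ^ (2 * ℓ + 3) + (ℓ + 1) ^ 2 * N ^ (2 * ℓ + 3) := by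
          refine Nat.add_le_add_right (Nat.mul_le_mul_left _ ?_) _
          exact Nat.pow_le_pow_right hN1 (by omega)
      _ = _ := by ring
  constructor
  · -- soundness
    intro h
    have key : ∀ q : Q, Relation.ReflTransGen
        (fun q q' => ∃ l, R q q' l ∧ litEval α l = true) (⟨0, by omega⟩, ⟨∅, h0⟩) q →
        ∃ S ⊆ E, ((S : Set (Finset X)).Pairwise fun e f => Disjoint e f) ∧
        (∀ e ∈ S, α (Sum.inr e) = true) ∧
        (∀ j : Fin m, (j : ℕ) < q.1 → (∀ e ∈ S, g j ∉ e) → α (Sum.inl (g j)) = true) ∧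
        (∀ e ∈ S, ∃ j : Fin m, (j : ℕ) < q.1 ∧ g j ∈ e) ∧
        (q.2 : Finset (Finset X)) = S.filter (ActiveAt g q.1) := by
      intro q hq
      induction hq with
      | refl => exact ⟨∅, by simp, by simp, by simp, by simp, by simp, by simp⟩
      | @tail q q' _ hstep ih =>
        obtain ⟨S, hSE, hdis, hα, hcov, hmeet, hF⟩ := ih
        obtain ⟨l, ⟨j, hj, hj', hl⟩, hlit⟩ := hstep
        rw [hj] at hF hcov hmeet
        rw [hj']
        have hfil : (S.filter (ActiveAt g j)).filter (ActiveAt g (j + 1)) =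
            S.filter (ActiveAt g (j + 1)) := by
          ext e
          simp only [Finset.mem_filter]
          constructor
          · rintro ⟨⟨h1, -⟩, h2⟩; exact ⟨h1, h2⟩
          · rintro ⟨h1, h2⟩
            refine ⟨⟨h1, hmeet e h1, ?_⟩, h2⟩
            obtain ⟨i, hi, hi'⟩ := h2.2
            exact ⟨i, by omega, hi'⟩
        have hmeet' : ∀ e ∈ S, ∃ i : Fin m, (i : ℕ) < (j : ℕ) + 1 ∧ g i ∈ e := by
          intro e he
          obtain ⟨i, hi, hi'⟩ := hmeet e he
          exact ⟨i, by omega, hi'⟩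
        have hcase : ∀ i : Fin m, (i : ℕ) < (j : ℕ) + 1 → (i : ℕ) < j ∨ i = j := by
          intro i hi
          rcases Nat.lt_succ_iff_lt_or_eq.1 hi with h | h
          · exact Or.inl h
          · exact Or.inr (Fin.ext h)
        rcases hl with ⟨rfl, hq'⟩ | ⟨rfl, ⟨e, he, hge⟩, hq'⟩ | ⟨e, he, rfl, hge, hfirst, hd, hq'⟩
        · refine ⟨S, hSE, hdis, hα, ?_, hmeet', by rw [hq', hF, hfil]⟩
          intro i hi hn
          rcases hcase i hi with h | rfl
          · exact hcov i h hn
          · simpa [litEval] using hlit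
        · refine ⟨S, hSE, hdis, hα, ?_, hmeet', by rw [hq', hF, hfil]⟩
          intro i hi hn
          rcases hcase i hi with h | rfl
          · exact hcov i h hn
          · rw [hF] at he
            exact absurd hge (hn e (Finset.mem_filter.1 he).1)
        · have hdS : ∀ f ∈ S, Disjoint e f := by
            intro f hf
            by_cases hact : ActiveAt g j f
            · exact hd f (by rw [hF]; exact Finset.mem_filter.2 ⟨hf, hact⟩)
            · rw [Finset.disjoint_left]
              intro x hxe hxf
              obtain ⟨i, rfl⟩ := hE e he x hxe
              have h1 : ¬ i < j := fun h => hfirst i h hxe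
              exact hact ⟨hmeet f hf, i, by simpa using h1, hxf⟩
          refine ⟨insert e S, ?_, ?_, ?_, ?_, ?_, ?_⟩
          · exact Finset.insert_subset he hSE
          · rw [Finset.coe_insert]
            exact hdis.insert (fun f hf _ => ⟨hdS f hf, (hdS f hf).symm⟩)
          · intro f hf
            rcases Finset.mem_insert.1 hf with rfl | hf
            · simpa [litEval] using hlit
            · exact hα f hf
          · intro i hi hn
            rcases hcase i hi with h | rfl
            · exact hcov i h (fun f hf => hn f (Finset.mem_insert_of_mem hf))
            · exact absurd hge (hn e (Finset.mem_insert_self _ _))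
          · intro f hf
            rcases Finset.mem_insert.1 hf with rfl | hf
            · exact ⟨j, by omega, hge⟩
            · exact hmeet' f hf
          · rw [hq', hF, Finset.filter_insert, Finset.filter_insert, hfil]
    obtain ⟨S, h1, h2, h3, h4, -⟩ := key _ h
    exact ⟨S, h1, h2, h3, fun j => h4 j j.2⟩
  · -- completeness
    rintro ⟨S, hSE, hdis, hα, hcov⟩
    have hFs : ∀ k, S.filter (ActiveAt g k) ∈ Fs := by
      intro k
      simp only [Fs, Finset.mem_filter, Finset.mem_powerset]
      refine ⟨(Finset.filter_subset _ _).trans hSE, ?_⟩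
      refine hb _ ((Finset.filter_subset _ _).trans hSE) (hdis.mono ?_) k ?_
      · exact_mod_cast Finset.filter_subset _ _
      · intro e he; exact (Finset.mem_filter.1 he).2
    have huniq : ∀ e ∈ S, ∀ f ∈ S, ∀ x, x ∈ e → x ∈ f → e = f := by
      intro e he f hf x hxe hxf
      by_contra hne
      exact Finset.disjoint_left.1 (hdis he hf hne) hxe hxf
    have key : ∀ k (hk : k ≤ m), Relation.ReflTransGen
        (fun q q' => ∃ l, R q q' l ∧ litEval α l = true) (⟨0, by omega⟩, ⟨∅, h0⟩)
        (⟨k, by omega⟩, ⟨S.filter (ActiveAt g k), hFs k⟩) := by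
      intro k
      induction k with
      | zero =>
        intro hk
        have : S.filter (ActiveAt g 0) = ∅ := by
          refine Finset.filter_false_of_mem ?_
          rintro e - ⟨⟨j, hj, -⟩, -⟩
          omega
        simp only [this]
        exact Relation.ReflTransGen.refl
      | succ k ih =>
        intro hk
        refine (ih (by omega)).tail ?_
        let j : Fin m := ⟨k, by omega⟩
        have hnew : ∀ f ∈ S, ActiveAt g (k + 1) f → ActiveAt g k f ∨
            (g j ∈ f ∧ ¬ ActiveAt g k f) := by
          intro f hf hact
          by_cases h : ActiveAt g k f
          · exact Or.inl h
          · refine Or.inr ⟨?_, h⟩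
            obtain ⟨⟨i, hi, hi'⟩, i2, hi2, hi2'⟩ := hact
            rcases Nat.lt_succ_iff_lt_or_eq.1 hi with h' | h'
            · exact absurd ⟨⟨i, h', hi'⟩, i2, by omega, hi2'⟩ h
            · have : i = j := Fin.ext h'
              exact this ▸ hi'
        by_cases hc : ∃ e ∈ S, g j ∈ e
        · obtain ⟨e, he, hge⟩ := hc
          by_cases hact : ActiveAt g k e
          · refine ⟨Sum.inl true, ⟨j, rfl, rfl, Or.inr (Or.inl ⟨rfl, ⟨e, ?_, hge⟩, ?_⟩)⟩, rfl⟩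
            · exact Finset.mem_filter.2 ⟨he, hact⟩
            · ext f
              simp only [Finset.mem_filter]
              constructor
              · rintro ⟨h1, h2⟩
                refine ⟨⟨h1, ?_⟩, h2⟩
                rcases hnew f h1 h2 with h | ⟨h, -⟩
                · exact h
                · exact huniq e he f h1 _ hge h ▸ hact
              · rintro ⟨⟨h1, -⟩, h2⟩; exact ⟨h1, h2⟩
          · refine ⟨Sum.inr (Sum.inr e, true), ⟨j, rfl, rfl, Or.inr (Or.inr
              ⟨e, hSE he, rfl, hge, ?_, ?_, ?_⟩)⟩, by simp [litEval, hα e he]⟩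
            · intro j' hj' hje
              exact hact ⟨⟨j', hj', hje⟩, j, le_rfl, hge⟩
            · intro f hf
              obtain ⟨hf1, hf2⟩ := Finset.mem_filter.1 hf
              exact hdis he hf1 (fun h => hact (h ▸ hf2))
            · ext f
              simp only [Finset.mem_filter, Finset.mem_insert]
              constructor
              · rintro ⟨h1, h2⟩
                refine ⟨?_, h2⟩
                rcases hnew f h1 h2 with h | ⟨h, -⟩
                · exact Or.inr ⟨h1, h⟩
                · exact Or.inl (huniq e he f h1 _ hge h).symm
              · rintro ⟨rfl | ⟨h1, -⟩, h2⟩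
                · exact ⟨he, h2⟩
                · exact ⟨h1, h2⟩
        · push Not at hc
          refine ⟨Sum.inr (Sum.inl (g j), true), ⟨j, rfl, rfl, Or.inl ⟨rfl, ?_⟩⟩,
            by simp [litEval, hcov j hc]⟩
          ext f
          simp only [Finset.mem_filter]
          constructor
          · rintro ⟨h1, h2⟩
            refine ⟨⟨h1, ?_⟩, h2⟩
            rcases hnew f h1 h2 with h | ⟨h, -⟩
            · exact h
            · exact absurd h (hc f h1)
          · rintro ⟨⟨h1, -⟩, h2⟩; exact ⟨h1, h2⟩
    have := key m le_rfl
    have hm : S.filter (ActiveAt g m) = ∅ := by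
      refine Finset.filter_false_of_mem ?_
      rintro e - ⟨-, ⟨j, hj, -⟩⟩
      omega
    simpa only [hm] using this

lemma exists_step {Y : Type*} {r : Y → Y → Prop} (P : Y → Prop) {a b : Y}
    (h : Relation.ReflTransGen r a b) (ha : P a) (hb : ¬ P b) :
    ∃ x y, r x y ∧ P x ∧ ¬ P y := by
  induction h with
  | refl => exact absurd ha hb
  | @tail y z _ hyz ih =>
    by_cases hy : P y
    · exact ⟨y, z, hyz, hy, hb⟩
    · exact ih hy

/-- At most as many disjoint active connected edge sets as there are childless vertices. -/
lemma active_bound {V : Type*} [Fintype V] [DecidableEq V] (r : V) (p : V → V) (d : V → ℕ)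
    (hpr : p r = r) (hd : ∀ v, v ≠ r → d v = d (p v) + 1)
    {m : ℕ} (w : Fin m → V) (hw : Function.Injective w) (hwr : ∀ j, w j ≠ r)
    (hsurj : ∀ v, v ≠ r → ∃ j, w j = v) (hmono : Monotone (d ∘ w))
    (L : Finset V) (hL : ∀ v, v ≠ r → (∀ u, u ≠ r → p u ≠ v) → v ∈ L)
    (S : Finset (Finset (Sym2 V)))
    (hdis : (S : Set (Finset (Sym2 V))).Pairwise fun e f => Disjoint e f)
    (hS : ∀ e ∈ S, ∀ x ∈ e, ∃ j, s(w j, p (w j)) = x)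
    (hconn : ∀ e ∈ S, ∀ a ∈ e, ∀ b ∈ e,
      Relation.ReflTransGen (fun x y => x ∈ e ∧ y ∈ e ∧ ∃ v : V, v ∈ x ∧ v ∈ y) a b)
    (k : ℕ) (hact : ∀ e ∈ S, ActiveAt (fun j => s(w j, p (w j))) k e) :
    S.card ≤ L.card := by
  classical
  have hdle : ∀ n v, d (p^[n] v) ≤ d v := by
    intro n
    induction n with
    | zero => intro v; simp
    | succ n ih =>
      intro v
      rw [Function.iterate_succ_apply]
      refine (ih _).trans ?_
      by_cases hv : v = r
      · rw [hv, hpr]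
      · rw [hd v hv]; omega
  have hidx : ∀ a b, d (w a) < d (w b) → a < b := by
    intro a b h
    by_contra hab
    exact absurd (hmono (not_lt.1 hab)) (by simpa using h)
  have hinj : ∀ a b, s(w a, p (w a)) = s(w b, p (w b)) → a = b := by
    intro a b h
    rcases Sym2.eq_iff.1 h with ⟨h1, -⟩ | ⟨h1, h2⟩
    · exact hw h1
    · have e1 := hd _ (hwr a)
      have e2 := hd _ (hwr b)
      rw [h2] at e1; rw [← h1] at e2; omega
  -- a leaf below each vertex
  have hleaf : ∀ v, v ≠ r → ∃ z ∈ L, ∃ n, p^[n] z = v := by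
    intro v hv
    obtain ⟨z, hz, hmax⟩ := Finset.exists_max_image
      (Finset.univ.filter fun z => ∃ n, p^[n] z = v) d ⟨v, by simp; exact ⟨0, rfl⟩⟩
    simp only [Finset.mem_filter, Finset.mem_univ, true_and] at hz hmax
    obtain ⟨n, hn⟩ := hz
    refine ⟨z, hL z ?_ ?_, n, hn⟩
    · rintro rfl
      exact hv (by rw [← hn, Function.iterate_fixed hpr])
    · intro u hu huz
      have := hmax u ⟨n + 1, by rw [Function.iterate_succ_apply, huz, hn]⟩
      have h2 := hd u hu
      rw [huz] at h2
      omega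
  -- the boundary edge
  have hbd : ∀ e ∈ S, ∃ b : Fin m, k ≤ (b : ℕ) ∧ s(w b, p (w b)) ∈ e ∧
      ∀ n, p^[n] (p (w b)) ≠ r → ∃ c : Fin m, (c : ℕ) < k ∧ w c = p^[n] (p (w b)) := by
    intro e he
    obtain ⟨⟨i, hi, hie⟩, i2, hi2, hi2e⟩ := hact e he
    obtain ⟨x, y, ⟨hx, hy, v, hvx, hvy⟩, ⟨a, hak, rfl⟩, hPy⟩ :=
      exists_step (fun x => ∃ a : Fin m, (a : ℕ) < k ∧ s(w a, p (w a)) = x)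
        (hconn e he _ hie _ hi2e) ⟨i, hi, rfl⟩ (by
          rintro ⟨a, ha, hae⟩
          have := hinj _ _ hae
          subst this
          omega)
    obtain ⟨b, rfl⟩ := hS e he y hy
    have hbk : k ≤ (b : ℕ) := by
      by_contra h
      exact hPy ⟨b, not_le.1 h, rfl⟩
    refine ⟨b, hbk, hy, ?_⟩
    have hab : a < b := by
      show (a : ℕ) < b
      omega
    have hsmall : ∀ u, u ≠ r → d u < d (w a) → ∃ c : Fin m, (c : ℕ) < k ∧ w c = u := by
      intro u hu hlt
      obtain ⟨c, rfl⟩ := hsurj u hu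
      have : (c : ℕ) < a := hidx _ _ hlt
      exact ⟨c, by omega, rfl⟩
    have hda := hd _ (hwr a)
    have hdb := hd _ (hwr b)
    intro n hn
    rcases Sym2.mem_iff.1 hvx with h1 | h1 <;> rcases Sym2.mem_iff.1 hvy with h2 | h2
    · exact absurd (hw (h1.symm.trans h2)) hab.ne
    · have hpb : p (w b) = w a := h2.symm.trans h1
      rw [hpb] at hn ⊢
      cases n with
      | zero => exact ⟨a, hak, rfl⟩
      | succ n =>
        refine hsmall _ hn ?_
        rw [Function.iterate_succ_apply]
        have := hdle n (p (w a))
        omega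
    · have hpa : p (w a) = w b := h1.symm.trans h2
      rw [hpa] at hda
      have := hmono hab.le
      simp only [Function.comp] at this
      omega
    · have hpp : p (w b) = p (w a) := h2.symm.trans h1
      rw [hpp] at hn ⊢
      refine hsmall _ hn ?_
      have := hdle n (p (w a))
      omega
  have hbd2 : ∀ e : Finset (Sym2 V), ∃ z : V, e ∈ S → ∃ b : Fin m, k ≤ (b : ℕ) ∧
      s(w b, p (w b)) ∈ e ∧
      (∀ n, p^[n] (p (w b)) ≠ r → ∃ c : Fin m, (c : ℕ) < k ∧ w c = p^[n] (p (w b))) ∧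
      z ∈ L ∧ ∃ n, p^[n] z = w b := by
    intro e
    by_cases he : e ∈ S
    · obtain ⟨b, h1, h2, h3⟩ := hbd e he
      obtain ⟨z, hz, hn⟩ := hleaf (w b) (hwr b)
      exact ⟨z, fun _ => ⟨b, h1, h2, h3, hz, hn⟩⟩
    · exact ⟨r, fun h => absurd h he⟩
  choose ζ hζ using hbd2
  refine Finset.card_le_card_of_injOn ζ ?_ ?_
  · intro e he
    obtain ⟨b, -, -, -, h, -⟩ := hζ e he
    exact h
  · intro e he f hf hef
    obtain ⟨b, hb1, hb2, hb3, -, n, hn⟩ := hζ e he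
    obtain ⟨c, hc1, hc2, hc3, -, n', hn'⟩ := hζ f hf
    rw [← hef] at hn'
    have aux : ∀ (z : V) (b c : Fin m) (n n' : ℕ), k ≤ (c : ℕ) →
        (∀ n, p^[n] (p (w b)) ≠ r → ∃ c : Fin m, (c : ℕ) < k ∧ w c = p^[n] (p (w b))) →
        p^[n] z = w b → p^[n'] z = w c → n < n' → False := by
      intro z b c n n' hck hb hn hn' hlt
      obtain ⟨q, rfl⟩ := Nat.exists_eq_add_of_lt hlt
      have : p^[q] (p (w b)) = w c := by
        rw [← hn', ← hn, ← Function.iterate_succ_apply, ← Function.iterate_add_apply]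
        have hq : q.succ + n = n + q + 1 := by omega
        rw [hq]
      obtain ⟨c', hc', hcc⟩ := hb q (by rw [this]; exact hwr c)
      rw [this] at hcc
      have := hw hcc
      subst this
      omega
    rcases lt_trichotomy n n' with h | h | h
    · exact (aux _ b c n n' hc1 hb3 hn hn' h).elim
    · subst h
      have hbc : b = c := hw (hn.symm.trans hn')
      subst hbc
      by_contra hne
      exact Finset.disjoint_left.1 (hdis he hf hne) hb2 hc2
    · exact (aux _ c b n' n hb1 hc3 hn' hn h).elim

/-- Rooted structure of a tree. -/
lemma tree_rooted {V : Type*} [Fintype V] [DecidableEq V] (T : SimpleGraph V)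
    [DecidableRel T.Adj] (hT : T.IsTree) :
    ∃ (r : V) (p : V → V) (d : V → ℕ), p r = r ∧ (∀ v, v ≠ r → d v = d (p v) + 1) ∧
      (∀ v, v ≠ r → T.Adj v (p v)) ∧
      (∀ x ∈ T.edgeFinset, ∃ v, v ≠ r ∧ s(v, p v) = x) := by
  classical
  obtain ⟨r⟩ := hT.1.nonempty
  have hpar : ∀ v, ∃ u, (v = r → u = r) ∧
      (v ≠ r → T.Adj v u ∧ T.dist v r = T.dist u r + 1) := by
    intro v
    by_cases hv : v = r
    · exact ⟨r, fun _ => rfl, fun h => absurd hv h⟩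
    · obtain ⟨q, hq⟩ := hT.1.exists_walk_length_eq_dist v r
      cases q with
      | nil => exact absurd rfl hv
      | @cons _ u _ h q =>
        refine ⟨u, fun h => absurd h hv, fun _ => ⟨h, ?_⟩⟩
        rw [SimpleGraph.Walk.length_cons] at hq
        have h1 := SimpleGraph.dist_le q
        obtain ⟨q', hq'⟩ := hT.1.exists_walk_length_eq_dist u r
        have h2 := SimpleGraph.dist_le (SimpleGraph.Walk.cons h q')
        rw [SimpleGraph.Walk.length_cons] at h2
        omega
  choose p hp1 hp2 using hpar
  refine ⟨r, p, fun v => T.dist v r, hp1 r rfl, fun v hv => (hp2 v hv).2,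
    fun v hv => (hp2 v hv).1, ?_⟩
  have hsub : (Finset.univ.erase r).image (fun v => s(v, p v)) ⊆ T.edgeFinset := by
    intro x hx
    obtain ⟨v, hv, rfl⟩ := Finset.mem_image.1 hx
    rw [SimpleGraph.mem_edgeFinset, SimpleGraph.mem_edgeSet]
    exact (hp2 v (Finset.ne_of_mem_erase hv)).1
  have hcard : ((Finset.univ.erase r).image (fun v => s(v, p v))).card = T.edgeFinset.card := by
    rw [Finset.card_image_of_injOn]
    · have := hT.card_edgeFinset
      rw [Finset.card_erase_of_mem (Finset.mem_univ _), Finset.card_univ]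
      omega
    · intro a ha b hb h
      have ha' := (hp2 a (by simpa using ha)).2
      have hb' := (hp2 b (by simpa using hb)).2
      rcases Sym2.eq_iff.1 h with ⟨h1, -⟩ | ⟨h1, h2⟩
      · exact h1
      · rw [h2] at ha'; rw [← h1] at hb'; omega
  have heq := Finset.eq_of_subset_of_card_le hsub hcard.ge
  intro x hx
  rw [← heq] at hx
  obtain ⟨v, hv, rfl⟩ := Finset.mem_image.1 hx
  exact ⟨v, Finset.ne_of_mem_erase hv, rfl⟩

/-- Fix `ℓ ≥ 2`.  For any tree hypergraph `H = (V, E)` whose underlying tree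
has at most `ℓ` leaves, the hypergraph function `f_H` can be computed by a nondeterministic
branching program of size polynomial in `|H|`. -/
theorem stmt_13 (ℓ : ℕ) (hℓ : 2 ≤ ℓ) :
    ∃ c k : ℕ,
      ∀ (VT : Type) [Fintype VT] [DecidableEq VT] (T : SimpleGraph VT)
        [DecidableRel T.Adj],
        T.IsTree →
        (Finset.univ.filter fun v : VT => T.degree v = 1).card ≤ ℓ →
        ∀ E : Finset (Finset (Sym2 VT)),
          (∀ e ∈ E, (e : Set (Sym2 VT)) ⊆ T.edgeSet ∧ ConvexSub T e) →
          ∃ B : NBP (Sym2 VT ⊕ Finset (Sym2 VT)),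
            B.size ≤ c * (T.edgeFinset.card + E.card + 1) ^ k ∧
            ∀ α, B.Accepts α ↔ fHtree T E α := by
  classical
  refine ⟨(ℓ + 1) + (ℓ + 1) ^ 2, 2 * ℓ + 3, ?_⟩
  intro VT _ _ T _ hT hleaves E hE
  obtain ⟨r, p, d, hpr, hd, hadj, hcov⟩ := tree_rooted T hT
  -- enumerate the non-root vertices by depth
  let m := Fintype.card {v : VT // v ≠ r}
  let ε : Fin m ≃ {v : VT // v ≠ r} := (Fintype.equivFin {v : VT // v ≠ r}).symm
  let σ := Tuple.sort (fun i => d (ε i).1)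
  let w : Fin m → VT := fun i => (ε (σ i)).1
  have hw : Function.Injective w := by
    intro a b h
    exact σ.injective (ε.injective (Subtype.ext h))
  have hwr : ∀ j, w j ≠ r := fun j => (ε (σ j)).2
  have hsurj : ∀ v, v ≠ r → ∃ j, w j = v := by
    intro v hv
    exact ⟨σ.symm (ε.symm ⟨v, hv⟩), by simp [w]⟩
  have hmono : Monotone (d ∘ w) := Tuple.monotone_sort (fun i => d (ε i).1)
  have hm : m = T.edgeFinset.card := by
    have h1 := hT.card_edgeFinset
    have h2 : m = Fintype.card VT - 1 := by
      simp [m, Fintype.card_subtype_compl]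
    omega
  have hgcov : ∀ x ∈ T.edgeFinset, ∃ j, s(w j, p (w j)) = x := by
    intro x hx
    obtain ⟨v, hv, rfl⟩ := hcov x hx
    obtain ⟨j, rfl⟩ := hsurj v hv
    exact ⟨j, rfl⟩
  have hEcov : ∀ e ∈ E, ∀ x ∈ e, ∃ j, s(w j, p (w j)) = x := by
    intro e he x hx
    exact hgcov x (SimpleGraph.mem_edgeFinset.2 ((hE e he).1 hx))
  have hL : ∀ v, v ≠ r → (∀ u, u ≠ r → p u ≠ v) →
      v ∈ Finset.univ.filter fun v : VT => T.degree v = 1 := by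
    intro v hv hch
    simp only [Finset.mem_filter, Finset.mem_univ, true_and]
    rw [← SimpleGraph.card_neighborFinset_eq_degree, Finset.card_eq_one]
    refine ⟨p v, ?_⟩
    ext u
    rw [SimpleGraph.mem_neighborFinset, Finset.mem_singleton]
    constructor
    · intro h
      obtain ⟨x, hx, hxe⟩ := hcov s(v, u) (by
        rw [SimpleGraph.mem_edgeFinset, SimpleGraph.mem_edgeSet]; exact h)
      rcases Sym2.eq_iff.1 hxe with ⟨h1, h2⟩ | ⟨h1, h2⟩
      · rw [← h2, h1]
      · exact absurd h2 (hch x hx)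
    · rintro rfl
      exact hadj v hv
  obtain ⟨B, hB, hacc⟩ := sweep (fun j => s(w j, p (w j))) E hEcov ℓ (by
    intro S hS hdis k hact
    refine le_trans ?_ hleaves
    exact active_bound r p d hpr hd w hw hwr hsurj hmono _ hL S hdis
      (fun e he => hEcov e (hS he)) (fun e he => (hE e (hS he)).2.2.1) k hact)
  refine ⟨B, by rw [← hm]; exact hB, fun α => (hacc α).trans ?_⟩
  unfold fHtree
  refine exists_congr fun S => and_congr_right fun _ => and_congr_right fun _ =>
    and_congr_right fun _ => ?_
  constructor
  · intro h x hx hn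
    obtain ⟨j, rfl⟩ := hgcov x hx
    exact h j hn
  · intro h j hn
    refine h _ ?_ hn
    rw [SimpleGraph.mem_edgeFinset, SimpleGraph.mem_edgeSet]
    exact hadj _ (hwr j)
end
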